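/- arXiv:1307.1671 — 7 statements merged into one kernel-verified Lean document; each statement's English description precedes it below -/
import Mathlib

section
/- Let X and Y be sets, f : X → X, h : X → Y, and N ≥ 1 an integer. Suppose that for every ξ ∈ Y^N there is a unique η ∈ X with (h(η), h(f(η)), …, h(f^{N−1}(η))) = ξ. Let (x_k) be a solution of x_{k+1} = f(x_k), with output y_k = h(x_k). Let (z_k) and (η_k) be sequences in X such that for every k: h(f^i(η_k)) = h(f^i(z_k)) for i = 0, 1, …, N−2, h(f^{N−1}(η_k)) = y_k, and z_{k+1} = f(η_k). Then for all initial conditions, the estimate x̂_k := f^{N−1}(z_k) satisfies x̂_k = x_k for all k ≥ N. -/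
/-- **Nonlinear deadbeat observer (Theorem 1 / `thm:db`).**
System `x⁺ = f x`, `y = h x`; observer `z⁺ = f η`, `x̂ = f^[N-1] z`, where `η`
is chosen so that the first `N-1` would-be outputs of `η` match those of `z`
and the last would-be output of `η` matches the current measurement `y = h x`.
Under the uniqueness (observability) assumption, `x̂ k = x k` for all `k ≥ N`. -/
theorem stmt_0 {X Y : Type*} (f : X → X) (h : X → Y) (N : ℕ) (hN : 1 ≤ N)
    (hobs : ∀ ξ : Fin N → Y, ∃! η : X, (fun i : Fin N => h (f^[(i : ℕ)] η)) = ξ)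
    (x z η : ℕ → X)
    (hx : ∀ k, x (k + 1) = f (x k))
    (hmatch : ∀ k, ∀ i < N - 1, h (f^[i] (η k)) = h (f^[i] (z k)))
    (hlast : ∀ k, h (f^[N - 1] (η k)) = h (x k))
    (hz : ∀ k, z (k + 1) = f (η k)) :
    ∀ k, N ≤ k → f^[N - 1] (z k) = x k := by
  obtain ⟨n, rfl⟩ : ∃ n, N = n + 1 := ⟨N - 1, by omega⟩
  simp only [Nat.add_sub_cancel] at hmatch hlast ⊢
  have orbit : ∀ i m, f^[i] (x m) = x (m + i) := by
    intro i
    induction i with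
    | zero => intro m; rfl
    | succ i ih =>
      intro m
      rw [Function.iterate_succ_apply, ← hx, ih, Nat.add_right_comm, Nat.add_assoc]
  have output : ∀ j i m, j + i = n → h (f^[i] (η (m + j))) = h (x m) := by
    intro j
    induction j with
    | zero =>
      intro i m hi
      obtain rfl : i = n := by omega
      exact hlast m
    | succ j ih =>
      intro i m hi
      rw [hmatch _ i (by omega), ← Nat.add_assoc, hz, ← Function.iterate_succ_apply]
      exact ih (i + 1) m (by omega)
  have recover : ∀ m, η (m + n) = x m := by
    intro m
    refine (hobs fun i => h (f^[(i : ℕ)] (x m))).unique ?_ rfl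
    funext i
    have hi := output (n - i) i (m + i) (by omega)
    rwa [show m + (i : ℕ) + (n - i) = m + n by omega, ← orbit] at hi
  intro k hk
  obtain ⟨m, rfl⟩ := Nat.exists_eq_add_of_le' hk
  rw [← Nat.add_assoc, hz, recover, ← hx, orbit, Nat.add_right_comm]
end

section
/- Let A ∈ ℝ^{n×n}, C ∈ ℝ^{m×n}, and let N ≥ 1 be such that the matrix W := [Cᵀ, AᵀCᵀ, …, A^{(N−1)T}Cᵀ]ᵀ ∈ ℝ^{Nm×n} has full column rank n. Let R ∈ ℝ^{m×m} be symmetric positive definite. Let (x_k) solve x_{k+1} = A x_k with output y_k = C x_k, and let (z_k) satisfy z_{k+1} = A η_k where η_k is the (unique) minimizer over ξ ∈ ℝ^n of J(ξ, z_k, y_k) := ‖C A^{N−1} ξ − y_k‖²_R + Σ_{i=0}^{N−2} ‖C A^i ξ − C A^i z_k‖²_R. Then the estimate x̂_k := A^{N−1} z_k satisfies ‖x̂_k − x_k‖ → 0 as k → ∞, for all initial conditions x_0´ and z_0. -/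
open Matrix Filter Finset

/-- `‖v‖²_R = vᵀ R v`. -/
noncomputable def quadForm {m : ℕ} (R : Matrix (Fin m) (Fin m) ℝ) (v : Fin m → ℝ) : ℝ :=
  v ⬝ᵥ R.mulVec v

/-- The cost `J(ξ, z, y) = ‖C A^{N-1} ξ - y‖²_R + Σ_{i=0}^{N-2} ‖C A^i ξ - C A^i z‖²_R`. -/
noncomputable def Jcost {n m : ℕ} (A : Matrix (Fin n) (Fin n) ℝ) (C : Matrix (Fin m) (Fin n) ℝ)
    (R : Matrix (Fin m) (Fin m) ℝ) (N : ℕ) (ξ z : Fin n → ℝ) (y : Fin m → ℝ) : ℝ :=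
  quadForm R ((C * A ^ (N - 1)).mulVec ξ - y) +
    ∑ i ∈ Finset.range (N - 1), quadForm R ((C * A ^ i).mulVec ξ - (C * A ^ i).mulVec z)

lemma quadForm_nonneg {m : ℕ} {R : Matrix (Fin m) (Fin m) ℝ} (hR : R.PosDef)
    (v : Fin m → ℝ) : 0 ≤ quadForm R v := by
  simpa [quadForm] using hR.posSemidef.dotProduct_mulVec_nonneg v

lemma quadForm_smul_sub {m : ℕ} {R : Matrix (Fin m) (Fin m) ℝ} (hR : R.PosDef)
    (t : ℝ) (u v : Fin m → ℝ) :
    quadForm R (t • u - v) =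
      t ^ 2 * quadForm R u - 2 * t * (u ⬝ᵥ R.mulVec v) + quadForm R v := by
  have h : v ⬝ᵥ R.mulVec u = u ⬝ᵥ R.mulVec v := by
    rw [dotProduct_mulVec, ← mulVec_transpose, dotProduct_comm]
    have := hR.isHermitian.eq
    rw [conjTranspose_eq_transpose_of_trivial] at this
    rw [this]
  simp only [quadForm, mulVec_sub, mulVec_smul, dotProduct_sub, sub_dotProduct, smul_dotProduct,
    dotProduct_smul, smul_eq_mul, h]
  ring

/-- A real quadratic with nonnegative leading coefficient, minimal at `t = 1`. -/
lemma linear_coeff_eq_of_min_at_one {a b c : ℝ} (ha : 0 ≤ a)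
    (h : ∀ t : ℝ, a - 2 * b + c ≤ t ^ 2 * a - 2 * t * b + c) : b = a := by
  have h1 := h (1 - (a - b) / (a + 1))
  have h2 : (a - b) = (a - b) / (a + 1) * (a + 1) := by field_simp
  set s := (a - b) / (a + 1)
  have h3 : b = a - s * (a + 1) := by linarith
  rw [h3] at h1
  have h4 : s ^ 2 * (a + 2) ≤ 0 := by nlinarith
  have h5 : s = 0 := by nlinarith [sq_nonneg s, mul_nonneg (sq_nonneg s) ha]
  rw [h3, h5]; ring

/-- Energy identity for the minimizer of a regularized least-squares cost. -/
lemma energy_of_isMin {n m M : ℕ} {R : Matrix (Fin m) (Fin m) ℝ} (hR : R.PosDef)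
    (P : ℕ → Matrix (Fin m) (Fin n) ℝ) (ε e : Fin n → ℝ)
    (h : ∀ ξ : Fin n → ℝ,
      quadForm R ((P M).mulVec ε) +
          ∑ i ∈ Finset.range M, quadForm R ((P i).mulVec ε - (P i).mulVec e) ≤
        quadForm R ((P M).mulVec ξ) +
          ∑ i ∈ Finset.range M, quadForm R ((P i).mulVec ξ - (P i).mulVec e)) :
    quadForm R ((P M).mulVec ε) +
        ∑ i ∈ Finset.range M, quadForm R ((P i).mulVec ε - (P i).mulVec e) +
        ∑ i ∈ Finset.range (M + 1), quadForm R ((P i).mulVec ε) =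
      ∑ i ∈ Finset.range M, quadForm R ((P i).mulVec e) := by
  have expand (t : ℝ) : quadForm R ((P M).mulVec (t • ε)) +
      ∑ i ∈ Finset.range M, quadForm R ((P i).mulVec (t • ε) - (P i).mulVec e) =
      t ^ 2 * ∑ i ∈ Finset.range (M + 1), quadForm R ((P i).mulVec ε) -
        2 * t * ∑ i ∈ Finset.range M, ((P i).mulVec ε ⬝ᵥ R.mulVec ((P i).mulVec e)) +
        ∑ i ∈ Finset.range M, quadForm R ((P i).mulVec e) := by
    have h0 := quadForm_smul_sub hR t ((P M).mulVec ε) 0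
    have hz : quadForm R (0 : Fin m → ℝ) = 0 := by simp [quadForm]
    simp only [sub_zero, mulVec_zero, dotProduct_zero, mul_zero, hz, add_zero] at h0
    simp only [mulVec_smul, quadForm_smul_sub hR t, h0, Finset.sum_add_distrib,
      Finset.sum_sub_distrib, ← Finset.mul_sum, Finset.sum_range_succ]
    ring
  have expand_one := expand 1
  simp only [one_smul, one_pow, one_mul, mul_one] at expand_one
  have hab := linear_coeff_eq_of_min_at_one
    (a := ∑ i ∈ Finset.range (M + 1), quadForm R ((P i).mulVec ε))
    (b := ∑ i ∈ Finset.range M, ((P i).mulVec ε ⬝ᵥ R.mulVec ((P i).mulVec e)))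
    (c := ∑ i ∈ Finset.range M, quadForm R ((P i).mulVec e))
    (Finset.sum_nonneg fun i _ => quadForm_nonneg hR _) fun t => by
      rw [← expand t, ← expand_one]; exact h _
  rw [expand_one, hab]
  ring

lemma tendsto_zero_of_tendsto_quadForm {m : ℕ} {R : Matrix (Fin m) (Fin m) ℝ} (hR : R.PosDef)
    {v : ℕ → Fin m → ℝ} (h : Tendsto (fun k => quadForm R (v k)) atTop (nhds 0)) :
    Tendsto v atTop (nhds 0) := by
  obtain ⟨B, hBu, hB⟩ : ∃ B : Matrix (Fin m) (Fin m) ℝ, IsUnit B ∧ R = Bᵀ * B := by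
    open scoped MatrixOrder Matrix.Norms.L2Operator in
    obtain ⟨B, hBu, hB⟩ :=
      CStarAlgebra.isStrictlyPositive_iff_eq_star_mul_self.mp hR.isStrictlyPositive
    exact ⟨B, hBu, by rw [hB, star_eq_conjTranspose, conjTranspose_eq_transpose_of_trivial]⟩
  have hq (k : ℕ) : quadForm R (v k) = B.mulVec (v k) ⬝ᵥ B.mulVec (v k) := by
    rw [quadForm, hB, ← mulVec_mulVec, dotProduct_mulVec, vecMul_transpose]
  have hBv : Tendsto (fun k => B.mulVec (v k)) atTop (nhds 0) := by
    rw [tendsto_pi_nhds]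
    intro i
    refine squeeze_zero_norm (a := fun k => Real.sqrt (quadForm R (v k))) (fun k => ?_) ?_
    · refine Real.abs_le_sqrt ?_
      rw [hq, dotProduct, sq]
      exact Finset.single_le_sum (f := fun i => B.mulVec (v k) i * B.mulVec (v k) i)
        (fun j _ => mul_self_nonneg _) (Finset.mem_univ i)
    · simpa using h.sqrt
  have hc : Continuous fun u : Fin m → ℝ => B⁻¹.mulVec u := by fun_prop
  have := (hc.tendsto 0).comp hBv
  simpa [Function.comp_def, mulVec_mulVec,
    Matrix.nonsing_inv_mul B ((Matrix.isUnit_iff_isUnit_det B).1 hBu)] using this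

lemma tendsto_zero_of_tendsto_mulVec {ι : Type*} [Fintype ι] {n : ℕ} {W : Matrix ι (Fin n) ℝ}
    (hW : W.rank = n) {v : ℕ → Fin n → ℝ}
    (h : Tendsto (fun k => W.mulVec (v k)) atTop (nhds 0)) : Tendsto v atTop (nhds 0) := by
  have hinj : LinearMap.ker W.mulVecLin = ⊥ := by
    have := W.mulVecLin.finrank_range_add_finrank_ker
    rw [← Matrix.rank, hW] at this
    simp only [Module.finrank_fin_fun] at this
    exact Submodule.finrank_eq_zero.1 (by omega)
  obtain ⟨L, hL⟩ := W.mulVecLin.exists_leftInverse_of_injective hinj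
  have := (L.continuous_of_finiteDimensional.tendsto 0).comp h
  have hLv (k : ℕ) : L (W.mulVec (v k)) = v k := LinearMap.congr_fun hL (v k)
  simpa [Function.comp_def, hLv] using this

/-- Error dynamics driven by minimizers of the moving-horizon cost converge to zero. -/
lemma tendsto_zero_of_energy {n m M : ℕ} {A : Matrix (Fin n) (Fin n) ℝ}
    {C : Matrix (Fin m) (Fin n) ℝ}
    (hW : (Matrix.of fun (p : Fin (M + 1) × Fin m) (j : Fin n) =>
      (C * A ^ (p.1 : ℕ)) p.2 j).rank = n)
    {R : Matrix (Fin m) (Fin m) ℝ} (hR : R.PosDef) {ε : ℕ → Fin n → ℝ}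
    (h : ∀ k, quadForm R ((C * A ^ M).mulVec (ε (k + 1))) +
        ∑ i ∈ Finset.range M, quadForm R ((C * A ^ i).mulVec (ε (k + 1)) -
          (C * A ^ i).mulVec (A.mulVec (ε k))) +
        ∑ i ∈ Finset.range (M + 1), quadForm R ((C * A ^ i).mulVec (ε (k + 1))) =
      ∑ i ∈ Finset.range M, quadForm R ((C * A ^ i).mulVec (A.mulVec (ε k)))) :
    Tendsto ε atTop (nhds 0) := by
  have hshift (i : ℕ) (v : Fin n → ℝ) :
      (C * A ^ i).mulVec (A.mulVec v) = (C * A ^ (i + 1)).mulVec v := by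
    rw [mulVec_mulVec, Matrix.mul_assoc, ← pow_succ]
  simp only [hshift] at h
  set V : ℕ → ℝ := fun k => ∑ i ∈ Finset.range (M + 1), quadForm R ((C * A ^ i).mulVec (ε k))
  have hVs (k : ℕ) : V k = ∑ i ∈ Finset.range M, quadForm R ((C * A ^ (i + 1)).mulVec (ε k)) +
      quadForm R ((C * A ^ 0).mulVec (ε k)) := Finset.sum_range_succ' _ _
  have hV0 (k : ℕ) : 0 ≤ V k := Finset.sum_nonneg fun i _ => quadForm_nonneg hR _
  have hS0 (k : ℕ) : 0 ≤ ∑ i ∈ Finset.range M, quadForm R ((C * A ^ i).mulVec (ε (k + 1)) -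
      (C * A ^ (i + 1)).mulVec (ε k)) := Finset.sum_nonneg fun i _ => quadForm_nonneg hR _
  have hdec (k : ℕ) : quadForm R ((C * A ^ M).mulVec (ε (k + 1))) +
        ∑ i ∈ Finset.range M, quadForm R ((C * A ^ i).mulVec (ε (k + 1)) -
          (C * A ^ (i + 1)).mulVec (ε k)) + quadForm R ((C * A ^ 0).mulVec (ε k)) =
      V k - V (k + 1) := by
    rw [hVs k, ← h k]; ring
  have hanti : Antitone V := antitone_nat_of_succ_le fun k => by
    linarith [hdec k, hS0 k, quadForm_nonneg hR ((C * A ^ M).mulVec (ε (k + 1))),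
      quadForm_nonneg hR ((C * A ^ 0).mulVec (ε k))]
  have hlim := tendsto_atTop_ciInf hanti ⟨0, by rintro _ ⟨k, rfl⟩; exact hV0 k⟩
  have hdiff : Tendsto (fun k => V k - V (k + 1)) atTop (nhds 0) := by
    simpa using hlim.sub (hlim.comp (tendsto_add_atTop_nat 1))
  have hout : ∀ i ≤ M, Tendsto (fun k => (C * A ^ i).mulVec (ε k)) atTop (nhds 0) := by
    intro i
    induction i with
    | zero =>
      intro _
      refine tendsto_zero_of_tendsto_quadForm hR
        (squeeze_zero (fun k => quadForm_nonneg hR _) (fun k => ?_) hdiff)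
      linarith [hdec k, hS0 k, quadForm_nonneg hR ((C * A ^ M).mulVec (ε (k + 1)))]
    | succ i ih =>
      intro hi
      have hstep : Tendsto (fun k => (C * A ^ i).mulVec (ε (k + 1)) -
          (C * A ^ (i + 1)).mulVec (ε k)) atTop (nhds 0) := by
        refine tendsto_zero_of_tendsto_quadForm hR
          (squeeze_zero (fun k => quadForm_nonneg hR _) (fun k => ?_) hdiff)
        have := Finset.single_le_sum (f := fun i => quadForm R
          ((C * A ^ i).mulVec (ε (k + 1)) - (C * A ^ (i + 1)).mulVec (ε k)))
          (fun j _ => quadForm_nonneg hR _) (Finset.mem_range.2 (Nat.lt_of_succ_le hi))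
        linarith [hdec k, quadForm_nonneg hR ((C * A ^ M).mulVec (ε (k + 1))),
          quadForm_nonneg hR ((C * A ^ 0).mulVec (ε k))]
      simpa [Function.comp_def] using
        ((ih (by omega)).comp (tendsto_add_atTop_nat 1)).sub hstep
  refine tendsto_zero_of_tendsto_mulVec hW (tendsto_pi_nhds.2 fun p => ?_)
  exact tendsto_pi_nhds.1 (hout p.1 (Nat.lt_succ_iff.1 p.1.2)) p.2

/-- **Theorem 2 (`thm:asyobslin`): linear optimal moving-horizon observer.**
For the system `x⁺ = A x`, `y = C x` and the observer `z⁺ = A η`, `x̂ = A^{N-1} z`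
with `η = argmin_ξ J(ξ, z, y)`, if `W = [Cᵀ, AᵀCᵀ, …, A^{(N-1)T}Cᵀ]ᵀ` has full
column rank `n` and `R` is symmetric positive definite, then `‖x̂ k - x k‖ → 0`. -/
theorem stmt_1 {n m : ℕ} (A : Matrix (Fin n) (Fin n) ℝ) (C : Matrix (Fin m) (Fin n) ℝ)
    (N : ℕ) (hN : 1 ≤ N)
    (hW : (Matrix.of fun (p : Fin N × Fin m) (j : Fin n) =>
      (C * A ^ (p.1 : ℕ)) p.2 j).rank = n)
    (R : Matrix (Fin m) (Fin m) ℝ) (hR : R.PosDef)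
    (x z η : ℕ → Fin n → ℝ)
    (hx : ∀ k, x (k + 1) = A.mulVec (x k))
    (hη : ∀ k, ∀ ξ : Fin n → ℝ,
      Jcost A C R N (η k) (z k) (C.mulVec (x k)) ≤ Jcost A C R N ξ (z k) (C.mulVec (x k)))
    (hz : ∀ k, z (k + 1) = A.mulVec (η k)) :
    Tendsto (fun k => Real.sqrt
        (((A ^ (N - 1)).mulVec (z k) - x k) ⬝ᵥ ((A ^ (N - 1)).mulVec (z k) - x k)))
      atTop (nhds 0) := by
  obtain ⟨M, rfl⟩ : ∃ M, N = M + 1 := ⟨N - 1, by omega⟩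
  have hxM (k : ℕ) : ∀ j, x (k + j) = (A ^ j).mulVec (x k) := by
    intro j
    induction j with
    | zero => simp
    | succ j ih => rw [← add_assoc, hx, ih, mulVec_mulVec, ← pow_succ']
  have hmin (k : ℕ) := energy_of_isMin (M := M) hR (fun i => C * A ^ i) (η (k + M) - x k)
    (z (k + M) - x k) fun ξ => by
      have := hη (k + M) (ξ + x k)
      simpa [Jcost, hxM k M, mulVec_sub, mulVec_add, ← mulVec_mulVec, add_sub_right_comm,
        sub_sub_sub_cancel_right, sub_sub_eq_add_sub] using this
  have hε : Tendsto (fun k => η (k + M) - x k) atTop (nhds 0) := by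
    refine tendsto_zero_of_energy hW hR fun k => ?_
    have hz' : z (k + 1 + M) - x (k + 1) = A.mulVec (η (k + M) - x k) := by
      rw [add_right_comm, hz, hx, mulVec_sub]
    simpa only [hz'] using hmin (k + 1)
  rw [← tendsto_add_atTop_iff_nat (M + 1)]
  have hc : Continuous fun v : Fin n → ℝ => Real.sqrt
      ((A ^ M).mulVec (A.mulVec v) ⬝ᵥ (A ^ M).mulVec (A.mulVec v)) := by fun_prop
  have herr (k : ℕ) : (A ^ M).mulVec (z (k + (M + 1))) - x (k + (M + 1)) =
      (A ^ M).mulVec (A.mulVec (η (k + M) - x k)) := by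
    rw [hxM, ← add_assoc, hz, mulVec_sub, mulVec_sub, mulVec_mulVec (x k), ← pow_succ]
  simpa [Function.comp_def, herr] using (hc.tendsto 0).comp hε
end

section
/- Let A ∈ ℝ^{n×n}, B ∈ ℝ^{n×m}, and let N ≥ 1 be such that the matrix [B, AB, …, A^{N−1}B] has full row rank n. Let R ∈ ℝ^{m×m} be symmetric positive definite. Let (x_k) solve x_{k+1} = A x_k and let (x̂_k) solve x̂_{k+1} = A x̂_k + B u_k, where at each time u_k = v₀ and (v₀, v₁, …, v_{N−1}) minimizes Σ_{i=0}^{N−1} w_iᵀ R^{−1} w_i over all input sequences (w₀, …, w_{N−1}) subject to z₀ = x̂_k, z_{i+1} = A z_i + B w_i, and z_N = A^N x_k. Then ‖x̂_k − x_k‖ → 0 as k → ∞, for all initial conditions. -/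
open Matrix Filter Finset

/-- Trajectory of `z⁺ = A z + B w` from `z₀ = x0` under the input sequence `w`. -/
noncomputable def traj {n m : ℕ} (A : Matrix (Fin n) (Fin n) ℝ) (B : Matrix (Fin n) (Fin m) ℝ)
    (x0 : Fin n → ℝ) (w : ℕ → Fin m → ℝ) : ℕ → Fin n → ℝ
  | 0 => x0
  | k + 1 => A.mulVec (traj A B x0 w k) + B.mulVec (w k)

/-- The control energy `Σ_{i=0}^{N-1} w_iᵀ R⁻¹ w_i`. -/
noncomputable def energy {m : ℕ} (R : Matrix (Fin m) (Fin m) ℝ) (N : ℕ)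
    (w : ℕ → Fin m → ℝ) : ℝ :=
  ∑ i ∈ Finset.range N, w i ⬝ᵥ R⁻¹.mulVec (w i)

theorem traj_congr {n m : ℕ} (A : Matrix (Fin n) (Fin n) ℝ) (B : Matrix (Fin n) (Fin m) ℝ)
    (x0 : Fin n → ℝ) {w w' : ℕ → Fin m → ℝ} (k : ℕ) (h : ∀ i < k, w i = w' i) :
    traj A B x0 w k = traj A B x0 w' k := by
  induction k with
  | zero => rfl
  | succ k ih =>
    simp only [traj]
    rw [ih fun i hi => h i (by omega), h k (by omega)]

theorem traj_succ' {n m : ℕ} (A : Matrix (Fin n) (Fin n) ℝ) (B : Matrix (Fin n) (Fin m) ℝ)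
    (x0 : Fin n → ℝ) (w : ℕ → Fin m → ℝ) (k : ℕ) :
    traj A B x0 w (k + 1) =
      traj A B (A.mulVec x0 + B.mulVec (w 0)) (fun i => w (i + 1)) k := by
  induction k with
  | zero => rfl
  | succ k ih => rw [traj, ih, traj]

theorem traj_smul_add_smul {n m : ℕ} (A : Matrix (Fin n) (Fin n) ℝ)
    (B : Matrix (Fin n) (Fin m) ℝ) (a b : ℝ) (x y : Fin n → ℝ) (v w : ℕ → Fin m → ℝ) (k : ℕ) :
    traj A B (a • x + b • y) (fun i => a • v i + b • w i) k =
      a • traj A B x v k + b • traj A B y w k := by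
  induction k with
  | zero => rfl
  | succ k ih =>
    simp only [traj, ih, mulVec_add, mulVec_smul, smul_add]
    abel

/-- A finite-horizon trajectory from the origin vanishes in the limit if its inputs do. -/
theorem tendsto_traj_zero {n m : ℕ} (A : Matrix (Fin n) (Fin n) ℝ)
    (B : Matrix (Fin n) (Fin m) ℝ) (w : ℕ → ℕ → Fin m → ℝ) (N : ℕ)
    (h : ∀ i < N, Tendsto (fun k => w k i) atTop (nhds 0)) :
    Tendsto (fun k => traj A B 0 (w k) N) atTop (nhds 0) := by
  induction N with
  | zero => exact tendsto_const_nhds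
  | succ N ih =>
    have hA : Continuous fun z : Fin n → ℝ => A.mulVec z :=
      continuous_const.matrix_mulVec continuous_id
    have hB : Continuous fun z : Fin m → ℝ => B.mulVec z :=
      continuous_const.matrix_mulVec continuous_id
    have h1 := (hA.tendsto 0).comp (ih fun i hi => h i (by omega))
    have h2 := (hB.tendsto 0).comp (h N (by omega))
    simpa [Function.comp_def, traj] using h1.add h2

/-- A positive definite quadratic form dominates a positive multiple of the squared norm. -/
theorem Matrix.PosDef.exists_mul_sq_norm_le {m : ℕ} {P : Matrix (Fin m) (Fin m) ℝ}
    (hP : P.PosDef) : ∃ c > 0, ∀ a : Fin m → ℝ, c * ‖a‖ ^ 2 ≤ a ⬝ᵥ P.mulVec a := by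
  have hcont : Continuous fun a : Fin m → ℝ => a ⬝ᵥ P.mulVec a :=
    continuous_id.dotProduct (continuous_const.matrix_mulVec continuous_id)
  have hpos : ∀ a : Fin m → ℝ, a ≠ 0 → 0 < a ⬝ᵥ P.mulVec a := fun a ha => by
    simpa using hP.dotProduct_mulVec_pos ha
  obtain ⟨c, hc, hle⟩ : ∃ c > 0, ∀ a ∈ Metric.sphere (0 : Fin m → ℝ) 1,
      c ≤ a ⬝ᵥ P.mulVec a := by
    rcases (Metric.sphere (0 : Fin m → ℝ) 1).eq_empty_or_nonempty with he | hne
    · exact ⟨1, one_pos, by simp [he]⟩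
    · obtain ⟨b, hb, hmin⟩ :=
        (isCompact_sphere (0 : Fin m → ℝ) 1).exists_isMinOn hne hcont.continuousOn
      refine ⟨_, hpos b ?_, fun a ha => hmin ha⟩
      rintro rfl
      simp at hb
  refine ⟨c, hc, fun a => ?_⟩
  by_cases ha : a = 0
  · simp [ha]
  have hn : 0 < ‖a‖ := norm_pos_iff.mpr ha
  have h1 := hle (‖a‖⁻¹ • a) (by simp [norm_smul, hn.ne'])
  rw [mulVec_smul, smul_dotProduct, dotProduct_smul, smul_eq_mul, smul_eq_mul] at h1
  calc c * ‖a‖ ^ 2 ≤ (‖a‖⁻¹ * (‖a‖⁻¹ * (a ⬝ᵥ P.mulVec a))) * ‖a‖ ^ 2 := by gcongr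
    _ = a ⬝ᵥ P.mulVec a := by field_simp

theorem dotProduct_mulVec_nonneg_of_posDef {m : ℕ} {R : Matrix (Fin m) (Fin m) ℝ}
    (hR : R.PosDef) (a : Fin m → ℝ) : 0 ≤ a ⬝ᵥ R⁻¹.mulVec a := by
  simpa using hR.inv.posSemidef.dotProduct_mulVec_nonneg a

theorem energy_nonneg {m : ℕ} {R : Matrix (Fin m) (Fin m) ℝ} (hR : R.PosDef) (N : ℕ)
    (w : ℕ → Fin m → ℝ) : 0 ≤ energy R N w :=
  Finset.sum_nonneg fun _ _ => dotProduct_mulVec_nonneg_of_posDef hR _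

theorem energy_sub_eq {m : ℕ} (R : Matrix (Fin m) (Fin m) ℝ) (N : ℕ) (v w : ℕ → Fin m → ℝ) :
    energy R N (fun i => v i - w i) = 2 * energy R N v + 2 * energy R N w -
      4 * energy R N (fun i => (1 / 2 : ℝ) • v i + (1 / 2 : ℝ) • w i) := by
  simp only [energy, Finset.mul_sum, ← Finset.sum_add_distrib, ← Finset.sum_sub_distrib]
  refine Finset.sum_congr rfl fun i _ => ?_
  simp only [mulVec_add, mulVec_sub, mulVec_smul, dotProduct_add, dotProduct_sub, add_dotProduct,
    sub_dotProduct, dotProduct_smul, smul_dotProduct, smul_eq_mul]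
  ring

/-- The distance of a feasible input sequence to a minimum-energy one is controlled by its
excess energy. -/
theorem energy_sub_le_of_isMin {n m : ℕ} {A : Matrix (Fin n) (Fin n) ℝ}
    {B : Matrix (Fin n) (Fin m) ℝ} {R : Matrix (Fin m) (Fin m) ℝ} {N : ℕ} {x0 y : Fin n → ℝ}
    {v s : ℕ → Fin m → ℝ} (hv : traj A B x0 v N = y)
    (hmin : ∀ w, traj A B x0 w N = y → energy R N v ≤ energy R N w)
    (hs : traj A B x0 s N = y) :
    energy R N (fun i => s i - v i) ≤ 2 * (energy R N s - energy R N v) := by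
  have h := hmin (fun i => (1 / 2 : ℝ) • s i + (1 / 2 : ℝ) • v i) (by
    have h := traj_smul_add_smul A B (1 / 2) (1 / 2) x0 x0 s v N
    rw [hs, hv, ← add_smul, ← add_smul] at h
    norm_num at h ⊢
    exact h)
  rw [energy_sub_eq]
  linarith

/-- **Theorem 3 (`thm:asyconlin`, Kleinman): minimum energy moving-horizon tracker.**
If `[B, AB, …, A^{N-1}B]` has full row rank `n` and at each time `u_k` is the first
input of a minimum-energy sequence steering `x̂_k` to `A^N x_k` in `N` steps, then
`‖x̂_k - x_k‖ → 0`. -/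
theorem stmt_9 {n m : ℕ} (A : Matrix (Fin n) (Fin n) ℝ) (B : Matrix (Fin n) (Fin m) ℝ)
    (N : ℕ) (hN : 1 ≤ N)
    (hctr : (Matrix.of fun (i : Fin n) (p : Fin N × Fin m) =>
      (A ^ (p.1 : ℕ) * B) i p.2).rank = n)
    (R : Matrix (Fin m) (Fin m) ℝ) (hR : R.PosDef)
    (x xhat : ℕ → Fin n → ℝ) (u : ℕ → Fin m → ℝ)
    (hx : ∀ k, x (k + 1) = A.mulVec (x k))
    (hxhat : ∀ k, xhat (k + 1) = A.mulVec (xhat k) + B.mulVec (u k))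
    (hu : ∀ k, ∃ v : ℕ → Fin m → ℝ, v 0 = u k ∧
      traj A B (xhat k) v N = (A ^ N).mulVec (x k) ∧
      ∀ w : ℕ → Fin m → ℝ, traj A B (xhat k) w N = (A ^ N).mulVec (x k) →
        energy R N v ≤ energy R N w) :
    Tendsto (fun k => Real.sqrt ((xhat k - x k) ⬝ᵥ (xhat k - x k))) atTop (nhds 0) := by
  obtain ⟨M, rfl⟩ : ∃ M, N = M + 1 := ⟨N - 1, by omega⟩
  choose v hv0 hv hmin using hu
  -- The shifted optimal sequence, padded by zero, is feasible at the next time.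
  let s : ℕ → ℕ → Fin m → ℝ := fun k i => if i < M then v k (i + 1) else 0
  have hs : ∀ k, traj A B (xhat (k + 1)) (s k) (M + 1) =
      (A ^ (M + 1)).mulVec (x (k + 1)) := fun k => by
    have h := hv k
    rw [traj_succ', hv0, ← hxhat] at h
    rw [traj, traj_congr A B _ M (w' := fun i => v k (i + 1)) fun i hi => by simp [s, hi], h, hx]
    simp [s, mulVec_mulVec, ← pow_succ, ← pow_succ']
  have hes : ∀ k, energy R (M + 1) (s k) ≤ energy R (M + 1) (v k) := fun k => by
    have h1 : energy R (M + 1) (s k) =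
        ∑ i ∈ Finset.range M, v k (i + 1) ⬝ᵥ R⁻¹.mulVec (v k (i + 1)) := by
      rw [energy, Finset.sum_range_succ]
      simp only [s, lt_irrefl, if_false, zero_dotProduct, add_zero]
      refine Finset.sum_congr rfl fun i hi => ?_
      rw [if_pos (Finset.mem_range.mp hi)]
    rw [h1, energy, Finset.sum_range_succ']
    linarith [dotProduct_mulVec_nonneg_of_posDef hR (v k 0)]
  have hle : ∀ k, energy R (M + 1) (fun i => s k i - v (k + 1) i) ≤
      2 * (energy R (M + 1) (v k) - energy R (M + 1) (v (k + 1))) := fun k => by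
    linarith [energy_sub_le_of_isMin (hv (k + 1)) (hmin (k + 1)) (hs k), hes k]
  have hdec : Tendsto (fun k => 2 * (energy R (M + 1) (v k) - energy R (M + 1) (v (k + 1))))
      atTop (nhds 0) := by
    have hanti : Antitone fun k => energy R (M + 1) (v k) :=
      antitone_nat_of_succ_le fun k => (hmin (k + 1) _ (hs k)).trans (hes k)
    have hlim := tendsto_atTop_ciInf hanti
      ⟨0, by rintro _ ⟨k, rfl⟩; exact energy_nonneg hR _ _⟩
    simpa using (hlim.sub (hlim.comp (tendsto_add_atTop_nat 1))).const_mul 2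
  have hdiff : ∀ i < M + 1, Tendsto (fun k => s k i - v (k + 1) i) atTop (nhds 0) := by
    intro i hi
    obtain ⟨c, hc, hcoer⟩ := hR.inv.exists_mul_sq_norm_le
    have hsq : Tendsto (fun k => c * ‖s k i - v (k + 1) i‖ ^ 2) atTop (nhds 0) := by
      refine squeeze_zero (fun k => by positivity) (fun k => ?_) hdec
      refine (hcoer _).trans (le_trans ?_ (hle k))
      exact Finset.single_le_sum
        (f := fun j => (s k j - v (k + 1) j) ⬝ᵥ R⁻¹.mulVec (s k j - v (k + 1) j))
        (fun j _ => dotProduct_mulVec_nonneg_of_posDef hR _) (Finset.mem_range.mpr hi)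
    have h2 := (hsq.const_mul c⁻¹).sqrt
    simp only [inv_mul_cancel_left₀ hc.ne', Real.sqrt_sq (norm_nonneg _), mul_zero,
      Real.sqrt_zero] at h2
    exact tendsto_zero_iff_norm_tendsto_zero.mpr h2
  have hvlim : ∀ j ≤ M, Tendsto (fun k => v k (M - j)) atTop (nhds 0) := by
    intro j hj
    rw [← tendsto_add_atTop_iff_nat 1]
    induction j with
    | zero => simpa [s] using (hdiff M (by omega)).neg
    | succ j ih =>
      have h1 := (tendsto_add_atTop_iff_nat (f := fun k => v k (M - j)) 1).mp (ih (by omega))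
      have h2 := h1.sub (hdiff (M - (j + 1)) (by omega))
      have h3 : M - (j + 1) < M := by omega
      have h4 : M - (j + 1) + 1 = M - j := by omega
      simpa [s, h3, h4] using h2
  have hulim : Tendsto u atTop (nhds 0) := by
    simpa [hv0] using hvlim M le_rfl
  have hxh : ∀ k j, traj A B (xhat k) (fun i => u (k + i)) j = xhat (k + j) := by
    intro k j
    induction j with
    | zero => rfl
    | succ j ih => rw [traj, ih, ← add_assoc, hxhat]
  have hxp : ∀ k j, x (k + j) = (A ^ j).mulVec (x k) := by
    intro k j
    induction j with
    | zero => simp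
    | succ j ih => rw [← add_assoc, hx, ih, mulVec_mulVec, pow_succ']
  have herr : ∀ k, xhat (k + (M + 1)) - x (k + (M + 1)) =
      traj A B 0 (fun i => u (k + i) - v k i) (M + 1) := fun k => by
    have h := traj_smul_add_smul A B 1 (-1) (xhat k) (xhat k) (fun i => u (k + i)) (v k) (M + 1)
    rw [hxh, hv, ← hxp] at h
    simpa [← sub_eq_add_neg] using h.symm
  have hlim : Tendsto (fun k => xhat k - x k) atTop (nhds 0) := by
    rw [← tendsto_add_atTop_iff_nat (M + 1)]
    simp only [herr]
    refine tendsto_traj_zero A B _ _ fun i hi => ?_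
    have h1 := (tendsto_add_atTop_iff_nat i).mpr hulim
    have h2 := hvlim (M - i) (by omega)
    rw [Nat.sub_sub_self (by omega)] at h2
    simpa using h1.sub h2
  have hcont : Continuous fun z : Fin n → ℝ => Real.sqrt (z ⬝ᵥ z) :=
    (continuous_id.dotProduct continuous_id).sqrt
  simpa [Function.comp_def] using (hcont.tendsto 0).comp hlim
end

section
/- Let (X, ρ_x) and (Y, ρ_y) be complete metric spaces, f : X → X and h : X → Y uniformly continuous, N ≥ 1 an integer, and ℓ : Y × Y → ℝ_{≥0} a symmetric function satisfying α₁(ρ_y(v,w)) ≤ ℓ(v,w) ≤ α₂(ρ_y(v,w)) for all v, w ∈ Y, with α₁, α₂ ∈ K∞. Define J(ξ, z, y) := ℓ(h(f^{N−1}(ξ)), y) + Σ_{i=0}^{N−2} ℓ(h(f^i(ξ)), h(f^i(z))). Assume: (i) there exists α₃ ∈ K∞ with Σ_{i=0}^{N−1} ℓ(h(f^i(z)), h(f^i(x̃))) ≥ α₃(ρ_x(z, x̃)) for all z, x̃ ∈ X; (ii) there exists η : X × Y → X with J(η(z,y), z, y) < J(ξ, z, y) for all ξ ≠ η(z,y),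 and there exists α₄ ∈ K∞ such that for all z, x̃ ∈ X, writing η = η(z, h(f^{N−1}(x̃))), α₄(J(η, z, h(f^{N−1}(x̃)))) + Σ_{i=0}^{N−1} ℓ(h(f^i(η)), h(f^i(x̃))) ≤ Σ_{i=0}^{N−2} ℓ(h(f^i(z)), h(f^i(x̃))). Let (x_k) solve x_{k+1} = f(x_k) with y_k = h(x_k), let z_{k+1} = f(η(z_k, y_k)), and set x̂_k := f^{N−1}(z_k). Then: for each ε > 0 there exists δ > 0 such that ρ_x(x̂₀, x₀) ≤ δ implies ρ_x(x̂_k, x_k) ≤ ε for all k ∈ ℕ; and for all initial conditions, ρ_x(x̂_k, x_k) → 0 as k → ∞. -/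
open Filter Finset

/-- A function `α : ℝ≥0 → ℝ≥0` of class `K∞`: continuous, zero at zero, strictly
increasing, and unbounded (modelled on `ℝ`, restricted to `[0, ∞)`). -/
def IsKInf (α : ℝ → ℝ) : Prop :=
  ContinuousOn α (Set.Ici 0) ∧ α 0 = 0 ∧ StrictMonoOn α (Set.Ici 0) ∧
    Tendsto α atTop atTop

/-- The cost `J(ξ, z, y) = ℓ(h f^{N-1} ξ, y) + Σ_{i=0}^{N-2} ℓ(h f^i ξ, h f^i z)`. -/
def Jnl {X Y : Type*} (f : X → X) (h : X → Y) (ℓ : Y → Y → ℝ) (N : ℕ)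
    (ξ z : X) (y : Y) : ℝ :=
  ℓ (h (f^[N - 1] ξ)) y + ∑ i ∈ Finset.range (N - 1), ℓ (h (f^[i] ξ)) (h (f^[i] z))

open scoped Uniformity Topology

namespace IsKInf

variable {α : ℝ → ℝ} {ι : Type*} {l : Filter ι} {g c : ι → ℝ}

theorem pos (hα : IsKInf α) {t : ℝ} (ht : 0 < t) : 0 < α t := by
  simpa [hα.2.1] using hα.2.2.1 Set.self_mem_Ici ht.le ht

theorem nonneg (hα : IsKInf α) {t : ℝ} (ht : 0 ≤ t) : 0 ≤ α t := by
  rcases ht.eq_or_lt with rfl | ht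
  · exact hα.2.1.ge
  · exact (hα.pos ht).le

theorem tendsto_zero_comp (hα : IsKInf α) (hg : ∀ a, 0 ≤ g a) (h : Tendsto g l (𝓝 0)) :
    Tendsto (fun a => α (g a)) l (𝓝 0) := by
  have hα₀ := hα.1 0 Set.self_mem_Ici
  rw [ContinuousWithinAt, hα.2.1] at hα₀
  exact hα₀.comp (tendsto_nhdsWithin_iff.2 ⟨h, Eventually.of_forall hg⟩)

theorem tendsto_zero_of_comp_le (hα : IsKInf α) (hg : ∀ a, 0 ≤ g a) (hgc : ∀ a, α (g a) ≤ c a)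
    (h : Tendsto c l (𝓝 0)) : Tendsto g l (𝓝 0) := by
  refine tendsto_order.2 ⟨fun b hb => Eventually.of_forall fun a => hb.trans_le (hg a),
    fun b hb => ?_⟩
  filter_upwards [h.eventually_lt_const (hα.pos hb)] with a ha
  exact (hα.2.2.1.lt_iff_lt (hg a) hb.le).1 ((hgc a).trans_lt ha)

end IsKInf

section Cost

variable {X Y ι : Type*} {l : Filter ι} {ℓ : Y → Y → ℝ}
  {α₁ α₂ α₃ : ℝ → ℝ} {f : X → X} {h : X → Y} {n : ℕ}

theorem cost_nonneg [MetricSpace Y] (hα₁ : IsKInf α₁) (hℓ : ∀ v w, α₁ (dist v w) ≤ ℓ v w)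
    (v w : Y) : 0 ≤ ℓ v w :=
  (hα₁.nonneg dist_nonneg).trans (hℓ v w)

theorem tendsto_uniformity_of_cost [MetricSpace Y] (hα₁ : IsKInf α₁)
    (hℓ : ∀ v w, α₁ (dist v w) ≤ ℓ v w)
    {u v : ι → Y} (huv : Tendsto (fun a => ℓ (u a) (v a)) l (𝓝 0)) :
    Tendsto (fun a => (u a, v a)) l (𝓤 Y) :=
  tendsto_uniformity_iff_dist_tendsto_zero.2 <|
    hα₁.tendsto_zero_of_comp_le (fun _ => dist_nonneg) (fun _ => hℓ _ _) huv

theorem tendsto_cost_of_uniformity [MetricSpace Y] (hα₁ : IsKInf α₁) (hα₂ : IsKInf α₂)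
    (hℓ : ∀ v w, α₁ (dist v w) ≤ ℓ v w ∧ ℓ v w ≤ α₂ (dist v w))
    {u v : ι → Y} (huv : Tendsto (fun a => (u a, v a)) l (𝓤 Y)) :
    Tendsto (fun a => ℓ (u a) (v a)) l (𝓝 0) :=
  squeeze_zero (fun _ => cost_nonneg hα₁ (fun v w => (hℓ v w).1) _ _) (fun _ => (hℓ _ _).2) <|
    hα₂.tendsto_zero_comp (fun _ => dist_nonneg) (tendsto_uniformity_iff_dist_tendsto_zero.1 huv)

theorem UniformContinuous.tendsto_uniformity_comp [UniformSpace X] [UniformSpace Y]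
    {g : X → Y} (hg : UniformContinuous g)
    {u v : ι → X} (huv : Tendsto (fun a => (u a, v a)) l (𝓤 X)) :
    Tendsto (fun a => (g (u a), g (v a))) l (𝓤 Y) :=
  Tendsto.comp hg huv

theorem tendsto_uniformity_of_output [MetricSpace X] [MetricSpace Y]
    (hα₁ : IsKInf α₁) (hα₂ : IsKInf α₂)
    (hℓ : ∀ v w, α₁ (dist v w) ≤ ℓ v w ∧ ℓ v w ≤ α₂ (dist v w)) (hα₃ : IsKInf α₃)
    (hobs : ∀ z x : X, α₃ (dist z x) ≤ ∑ i ∈ range (n + 1), ℓ (h (f^[i] z)) (h (f^[i] x)))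
    {u v : ι → X}
    (huv : ∀ i ≤ n, Tendsto (fun a => (h (f^[i] (u a)), h (f^[i] (v a)))) l (𝓤 Y)) :
    Tendsto (fun a => (u a, v a)) l (𝓤 X) := by
  refine tendsto_uniformity_iff_dist_tendsto_zero.2 <|
    hα₃.tendsto_zero_of_comp_le (fun _ => dist_nonneg) (fun a => hobs (u a) (v a)) ?_
  rw [← sum_const_zero (s := range (n + 1))]
  exact tendsto_finsetSum _ fun i hi =>
    tendsto_cost_of_uniformity hα₁ hα₂ hℓ (huv i (Nat.lt_succ_iff.1 (mem_range.1 hi)))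

theorem Jnl_nonneg [MetricSpace Y] (hα₁ : IsKInf α₁) (hℓ : ∀ v w, α₁ (dist v w) ≤ ℓ v w)
    (N : ℕ) (ξ z : X) (y : Y) : 0 ≤ Jnl f h ℓ N ξ z y :=
  add_nonneg (cost_nonneg hα₁ hℓ _ _) (sum_nonneg fun _ _ => cost_nonneg hα₁ hℓ _ _)

/-- If the moving-horizon cost vanishes along a filter, then so does each of its terms. -/
theorem tendsto_uniformity_of_Jnl [MetricSpace Y] (hα₁ : IsKInf α₁)
    (hℓ : ∀ v w, α₁ (dist v w) ≤ ℓ v w)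
    {ξ z : ι → X} {y : ι → Y}
    (hJ : Tendsto (fun a => Jnl f h ℓ (n + 1) (ξ a) (z a) (y a)) l (𝓝 0)) :
    Tendsto (fun a => (h (f^[n] (ξ a)), y a)) l (𝓤 Y) ∧
      ∀ i < n, Tendsto (fun a => (h (f^[i] (ξ a)), h (f^[i] (z a)))) l (𝓤 Y) := by
  have h0 := cost_nonneg hα₁ hℓ
  refine ⟨tendsto_uniformity_of_cost hα₁ hℓ (squeeze_zero (fun _ => h0 _ _) (fun a => ?_) hJ),
    fun i hi =>
      tendsto_uniformity_of_cost hα₁ hℓ (squeeze_zero (fun _ => h0 _ _) (fun a => ?_) hJ)⟩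
  · exact le_add_of_nonneg_right (sum_nonneg fun _ _ => h0 _ _)
  · exact (single_le_sum (f := fun i => ℓ (h (f^[i] (ξ a))) (h (f^[i] (z a))))
      (fun _ _ => h0 _ _) (mem_range.2 hi)).trans (le_add_of_nonneg_left (h0 _ _))

theorem Jnl_min_le {N : ℕ} {η : X → Y → X} (h0 : ∀ v, ℓ v v = 0)
    (hη : ∀ (z : X) (y : Y) (ξ : X), ξ ≠ η z y → Jnl f h ℓ N (η z y) z y < Jnl f h ℓ N ξ z y)
    (z : X) (y : Y) : Jnl f h ℓ N (η z y) z y ≤ ℓ (h (f^[N - 1] z)) y := by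
  have hz : Jnl f h ℓ N z z y = ℓ (h (f^[N - 1] z)) y := by simp [Jnl, h0]
  rw [← hz]
  by_cases hzη : z = η z y
  · rw [← hzη]
  · exact (hη z y z hzη).le

end Cost

theorem iterate_orbit {X : Type*} {f : X → X} {x : ℕ → X} (hx : ∀ k, x (k + 1) = f (x k))
    (n k : ℕ) : f^[n] (x k) = x (k + n) := by
  induction n with
  | zero => rfl
  | succ n ih => rw [Function.iterate_succ_apply', ih, ← hx, Nat.add_assoc]

theorem UniformContinuous.iterate_self {X : Type*} [UniformSpace X] {f : X → X}
    (hf : UniformContinuous f) (n : ℕ) : UniformContinuous f^[n] := by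
  induction n with
  | zero => exact uniformContinuous_id
  | succ n ih => exact ih.comp hf

section Observer

variable {X Y : Type*} {ℓ : Y → Y → ℝ}
  {α₁ α₂ α₃ α₄ : ℝ → ℝ} {f : X → X} {h : X → Y} {n : ℕ} {η : X → Y → X}

theorem observer_decrease [MetricSpace Y] (hα₁ : IsKInf α₁) (hℓ : ∀ v w, α₁ (dist v w) ≤ ℓ v w)
    (hdecay : ∀ z x : X,
      α₄ (Jnl f h ℓ (n + 1) (η z (h (f^[n] x))) z (h (f^[n] x))) +
          ∑ i ∈ range (n + 1), ℓ (h (f^[i] (η z (h (f^[n] x))))) (h (f^[i] x)) ≤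
        ∑ i ∈ range n, ℓ (h (f^[i] z)) (h (f^[i] x)))
    (z x : X) :
    α₄ (Jnl f h ℓ (n + 1) (η z (h (f^[n] x))) z (h (f^[n] x))) +
        ∑ i ∈ range n, ℓ (h (f^[i] (f (η z (h (f^[n] x)))))) (h (f^[i] (f x))) ≤
      ∑ i ∈ range n, ℓ (h (f^[i] z)) (h (f^[i] x)) := by
  refine (add_le_add_right ?_ _).trans (hdecay z x)
  rw [sum_range_succ']
  exact le_add_of_nonneg_right (cost_nonneg hα₁ hℓ _ _)

theorem observer_tendsto [MetricSpace X] [MetricSpace Y] (hf : UniformContinuous f)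
    (hα₁ : IsKInf α₁) (hα₂ : IsKInf α₂)
    (hℓ : ∀ v w, α₁ (dist v w) ≤ ℓ v w ∧ ℓ v w ≤ α₂ (dist v w)) (hα₃ : IsKInf α₃)
    (hobs : ∀ z x : X, α₃ (dist z x) ≤ ∑ i ∈ range (n + 1), ℓ (h (f^[i] z)) (h (f^[i] x)))
    (hα₄ : IsKInf α₄)
    (hdecay : ∀ z x : X,
      α₄ (Jnl f h ℓ (n + 1) (η z (h (f^[n] x))) z (h (f^[n] x))) +
          ∑ i ∈ range (n + 1), ℓ (h (f^[i] (η z (h (f^[n] x))))) (h (f^[i] x)) ≤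
        ∑ i ∈ range n, ℓ (h (f^[i] z)) (h (f^[i] x)))
    {x z : ℕ → X} (hx : ∀ k, x (k + 1) = f (x k)) (hz : ∀ k, z (k + 1) = f (η (z k) (h (x k)))) :
    Tendsto (fun k => dist (f^[n] (z k)) (x k)) atTop (𝓝 0) := by
  have hℓ₁ := fun v w => (hℓ v w).1
  have hxn := iterate_orbit hx n
  let e : ℕ → X := fun k => η (z (k + n)) (h (x (k + n)))
  have hze : ∀ k, z (k + 1 + n) = f (e k) := fun k => by rw [Nat.add_right_comm, hz]
  let V : ℕ → ℝ := fun k => ∑ i ∈ range n, ℓ (h (f^[i] (z (k + n)))) (h (f^[i] (x k)))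
  have hV : ∀ k, α₄ (Jnl f h ℓ (n + 1) (e k) (z (k + n)) (h (x (k + n)))) ≤ V k - V (k + 1) := by
    intro k
    have := observer_decrease hα₁ hℓ₁ hdecay (z (k + n)) (x k)
    rw [hxn] at this
    simp only [V, hze, hx]
    exact le_sub_iff_add_le.2 this
  have hJ0 : ∀ k, 0 ≤ Jnl f h ℓ (n + 1) (e k) (z (k + n)) (h (x (k + n))) :=
    fun k => Jnl_nonneg hα₁ hℓ₁ _ _ _ _
  have hanti : Antitone V :=
    antitone_nat_of_succ_le fun k => sub_nonneg.1 ((hα₄.nonneg (hJ0 k)).trans (hV k))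
  have hbdd : BddBelow (Set.range V) :=
    ⟨0, by rintro _ ⟨k, rfl⟩; exact sum_nonneg fun _ _ => cost_nonneg hα₁ hℓ₁ _ _⟩
  have hlim := tendsto_atTop_ciInf hanti hbdd
  have hdiff : Tendsto (fun k => V k - V (k + 1)) atTop (𝓝 0) := by
    simpa using hlim.sub (hlim.comp (tendsto_add_atTop_nat 1))
  obtain ⟨hlast, hrest⟩ := tendsto_uniformity_of_Jnl hα₁ hℓ₁
    (hα₄.tendsto_zero_of_comp_le hJ0 hV hdiff)
  have hout : ∀ i ≤ n, Tendsto (fun k => (h (f^[i] (e k)), h (f^[i] (x k)))) atTop (𝓤 Y) := by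
    intro i hi
    induction hi using Nat.decreasingInduction with
    | self => simpa only [hxn] using hlast
    | of_succ i hi ih =>
      refine (tendsto_add_atTop_iff_nat 1).1 ?_
      have hprev := (hrest i hi).comp (tendsto_add_atTop_nat 1)
      simp only [Function.comp_def, hze] at hprev
      simp only [hx]
      exact hprev.uniformity_trans ih
  have hex := (hf.iterate_self (n + 1)).tendsto_uniformity_comp
    (tendsto_uniformity_of_output hα₁ hα₂ hℓ hα₃ hobs hout)
  refine (tendsto_add_atTop_iff_nat (n + 1)).1 ?_
  simpa only [iterate_orbit hx, Function.iterate_succ_apply, ← hze, Nat.add_right_comm _ 1 n,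
      ← Nat.add_assoc]
    using tendsto_uniformity_iff_dist_tendsto_zero.1 hex

/-- Uniform stability of the observer: the estimation errors, at arbitrary times, of a family of
trajectories vanish along any filter along which the initial errors vanish. -/
theorem observer_stable [MetricSpace X] [MetricSpace Y]
    (hf : UniformContinuous f) (hh : UniformContinuous h)
    (hα₁ : IsKInf α₁) (hα₂ : IsKInf α₂)
    (hℓ : ∀ v w, α₁ (dist v w) ≤ ℓ v w ∧ ℓ v w ≤ α₂ (dist v w)) (hα₃ : IsKInf α₃)
    (hobs : ∀ z x : X, α₃ (dist z x) ≤ ∑ i ∈ range (n + 1), ℓ (h (f^[i] z)) (h (f^[i] x)))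
    (hηmin : ∀ (z : X) (y : Y) (ξ : X),
      ξ ≠ η z y → Jnl f h ℓ (n + 1) (η z y) z y < Jnl f h ℓ (n + 1) ξ z y)
    (hα₄ : IsKInf α₄)
    (hdecay : ∀ z x : X,
      α₄ (Jnl f h ℓ (n + 1) (η z (h (f^[n] x))) z (h (f^[n] x))) +
          ∑ i ∈ range (n + 1), ℓ (h (f^[i] (η z (h (f^[n] x))))) (h (f^[i] x)) ≤
        ∑ i ∈ range n, ℓ (h (f^[i] z)) (h (f^[i] x)))
    {ι : Type*} {l : Filter ι} {x z : ι → ℕ → X} (hx : ∀ a k, x a (k + 1) = f (x a k))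
    (hz : ∀ a k, z a (k + 1) = f (η (z a k) (h (x a k))))
    (h0 : Tendsto (fun a => (f^[n] (z a 0), x a 0)) l (𝓤 X)) (k : ι → ℕ) :
    Tendsto (fun a => dist (f^[n] (z a (k a))) (x a (k a))) l (𝓝 0) := by
  have hℓ₁ := fun v w => (hℓ v w).1
  have hℓ0 : ∀ v, ℓ v v = 0 := fun v =>
    le_antisymm (by simpa [hα₂.2.1] using (hℓ v v).2) (cost_nonneg hα₁ hℓ₁ v v)
  -- If the estimate is accurate at time `j`, then the minimizer stays close to `z j`.
  have hstep : ∀ j, Tendsto (fun a => (f^[n] (z a j), x a j)) l (𝓤 X) →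
      Tendsto (fun a => (η (z a j) (h (x a j)), z a j)) l (𝓤 X) := by
    intro j hj
    have hy := hh.tendsto_uniformity_comp hj
    obtain ⟨hlast, hrest⟩ := tendsto_uniformity_of_Jnl (n := n) hα₁ hℓ₁ <|
      squeeze_zero (fun a => Jnl_nonneg hα₁ hℓ₁ _ _ _ _)
        (fun a => Jnl_min_le hℓ0 hηmin (z a j) (h (x a j)))
        (tendsto_cost_of_uniformity hα₁ hα₂ hℓ hy)
    refine tendsto_uniformity_of_output hα₁ hα₂ hℓ hα₃ hobs fun i hi => ?_
    rcases hi.lt_or_eq with hi | rfl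
    · exact hrest i hi
    · exact hlast.uniformity_trans hy.uniformity_symm
  have hfin : ∀ j, Tendsto (fun a => (f^[n] (z a j), x a j)) l (𝓤 X) ∧
      Tendsto (fun a => (z a j, f^[j] (z a 0))) l (𝓤 X) := by
    intro j
    induction j with
    | zero => exact ⟨h0, tendsto_diag_uniformity _ _⟩
    | succ j ih =>
      have hs := hf.tendsto_uniformity_comp (hstep j ih.1)
      simp only [← hz] at hs
      refine ⟨?_, ?_⟩
      · have h1 := (hf.iterate_self n).tendsto_uniformity_comp hs
        have h2 := hf.tendsto_uniformity_comp ih.1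
        simp only [← Function.iterate_succ_apply' f, ← Function.iterate_succ_apply f, ← hx]
          at h1 h2
        exact h1.uniformity_trans h2
      · simp only [Function.iterate_succ_apply']
        exact hs.uniformity_trans (hf.tendsto_uniformity_comp ih.2)
  -- The Lyapunov function is available from time `n` on, when `x` is in the range of `f^[n]`.
  have htail : ∀ m : ι → ℕ,
      Tendsto (fun a => dist (f^[n] (z a (m a + 1 + n))) (x a (m a + 1 + n))) l (𝓝 0) := by
    intro m
    have hxn := fun a => iterate_orbit (hx a) n
    have hze : ∀ a j, z a (j + 1 + n) = f (η (z a (j + n)) (h (x a (j + n)))) :=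
      fun a j => by rw [Nat.add_right_comm, hz]
    let V : ι → ℕ → ℝ := fun a j =>
      ∑ i ∈ range n, ℓ (h (f^[i] (z a (j + n)))) (h (f^[i] (x a j)))
    have hanti : ∀ a, Antitone (V a) := fun a => antitone_nat_of_succ_le fun j => by
      have hd := observer_decrease hα₁ hℓ₁ hdecay (z a (j + n)) (x a j)
      rw [hxn] at hd
      simp only [V, hze, hx]
      exact (le_add_of_nonneg_left (hα₄.nonneg (Jnl_nonneg hα₁ hℓ₁ _ _ _ _))).trans hd
    have hV0 : Tendsto (fun a => V a 0) l (𝓝 0) := by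
      rw [← sum_const_zero (ι := ℕ) (M := ℝ) (s := range n)]
      refine tendsto_finsetSum _ fun i _ => tendsto_cost_of_uniformity hα₁ hα₂ hℓ ?_
      simpa only [Nat.zero_add, Function.comp_apply] using
        (hh.comp (hf.iterate_self i)).tendsto_uniformity_comp ((hfin n).2.uniformity_trans h0)
    have hcost : ∀ a, α₃ (dist (η (z a (m a + n)) (h (x a (m a + n)))) (x a (m a))) ≤ V a 0 := by
      intro a
      have hd := hdecay (z a (m a + n)) (x a (m a))
      rw [hxn] at hd
      exact (hobs _ _).trans <|
        (le_add_of_nonneg_left (hα₄.nonneg (Jnl_nonneg hα₁ hℓ₁ _ _ _ _))).trans <|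
          hd.trans (hanti a (Nat.zero_le _))
    have hex := (hf.iterate_self (n + 1)).tendsto_uniformity_comp <|
      tendsto_uniformity_iff_dist_tendsto_zero.2 <|
        hα₃.tendsto_zero_of_comp_le (fun _ => dist_nonneg) hcost hV0
    simpa only [iterate_orbit (hx _), Function.iterate_succ_apply, ← hze, Nat.add_right_comm _ 1 n,
      ← Nat.add_assoc]
      using tendsto_uniformity_iff_dist_tendsto_zero.1 hex
  have hhead : Tendsto (fun a => ∑ j ∈ range (n + 1), dist (f^[n] (z a j)) (x a j)) l (𝓝 0) := by
    rw [← sum_const_zero (s := range (n + 1))]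
    exact tendsto_finsetSum _ fun j _ =>
      tendsto_uniformity_iff_dist_tendsto_zero.1 (hfin j).1
  refine squeeze_zero (fun _ => dist_nonneg) (fun a => ?_)
    (by simpa only [add_zero] using hhead.add (htail fun a => k a - (n + 1)))
  rcases lt_or_ge (k a) (n + 1) with hk | hk
  · exact (single_le_sum (f := fun j => dist (f^[n] (z a j)) (x a j)) (fun _ _ => dist_nonneg)
      (mem_range.2 hk)).trans (le_add_of_nonneg_right dist_nonneg)
  · rw [show k a - (n + 1) + 1 + n = k a by omega]
    exact le_add_of_nonneg_left (sum_nonneg fun _ _ => dist_nonneg)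

end Observer

/-- **Theorem 4 (`thm:asyobs`): nonlinear optimal moving-horizon observer.**
Under uniform observability (i) and the decrease condition (ii), the observer
`z⁺ = f(η(z, y))`, `x̂ = f^{N-1}(z)` is stable and convergent: small initial
estimation error stays small, and the estimation error tends to zero for all
initial conditions. -/
theorem stmt_12 {X Y : Type*} [MetricSpace X] [MetricSpace Y]
    [CompleteSpace X] [CompleteSpace Y]
    (f : X → X) (h : X → Y) (hf : UniformContinuous f) (hh : UniformContinuous h)
    (N : ℕ) (hN : 1 ≤ N)
    (ℓ : Y → Y → ℝ) (hsym : ∀ v w, ℓ v w = ℓ w v)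
    (α₁ α₂ : ℝ → ℝ) (hα₁ : IsKInf α₁) (hα₂ : IsKInf α₂)
    (hℓ : ∀ v w, α₁ (dist v w) ≤ ℓ v w ∧ ℓ v w ≤ α₂ (dist v w))
    (α₃ : ℝ → ℝ) (hα₃ : IsKInf α₃)
    (hobs : ∀ z xt : X, α₃ (dist z xt) ≤ ∑ i ∈ Finset.range N, ℓ (h (f^[i] z)) (h (f^[i] xt)))
    (η : X → Y → X)
    (hηmin : ∀ (z : X) (y : Y) (ξ : X), ξ ≠ η z y → Jnl f h ℓ N (η z y) z y < Jnl f h ℓ N ξ z y)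
    (α₄ : ℝ → ℝ) (hα₄ : IsKInf α₄)
    (hdecay : ∀ z xt : X,
      α₄ (Jnl f h ℓ N (η z (h (f^[N - 1] xt))) z (h (f^[N - 1] xt))) +
          ∑ i ∈ Finset.range N, ℓ (h (f^[i] (η z (h (f^[N - 1] xt))))) (h (f^[i] xt)) ≤
        ∑ i ∈ Finset.range (N - 1), ℓ (h (f^[i] z)) (h (f^[i] xt))) :
    (∀ ε > (0 : ℝ), ∃ δ > (0 : ℝ), ∀ x z : ℕ → X,
      (∀ k, x (k + 1) = f (x k)) → (∀ k, z (k + 1) = f (η (z k) (h (x k)))) →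
      dist (f^[N - 1] (z 0)) (x 0) ≤ δ → ∀ k, dist (f^[N - 1] (z k)) (x k) ≤ ε) ∧
    (∀ x z : ℕ → X,
      (∀ k, x (k + 1) = f (x k)) → (∀ k, z (k + 1) = f (η (z k) (h (x k)))) →
      Tendsto (fun k => dist (f^[N - 1] (z k)) (x k)) atTop (nhds 0)) := by
  obtain ⟨n, rfl⟩ := Nat.exists_eq_add_of_le' hN
  simp only [Nat.add_sub_cancel] at hdecay ⊢
  refine ⟨fun ε hε => ?_, fun x z hx hz =>
    observer_tendsto hf hα₁ hα₂ hℓ hα₃ hobs hα₄ hdecay hx hz⟩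
  by_contra! hcon
  choose x z hx hz h0 k hk using fun m : ℕ => hcon (1 / ((m : ℝ) + 1)) (by positivity)
  have hstart : Tendsto (fun m => (f^[n] (z m 0), x m 0)) atTop (𝓤 X) :=
    tendsto_uniformity_iff_dist_tendsto_zero.2 <|
      squeeze_zero (fun _ => dist_nonneg) h0 tendsto_one_div_add_atTop_nhds_zero_nat
  have hlim := observer_stable hf hh hα₁ hα₂ hℓ hα₃ hobs hηmin hα₄ hdecay hx hz hstart k
  obtain ⟨m, hm⟩ := (hlim.eventually_lt_const hε).exists
  exact (hk m).not_gt hm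
end

section
/- Let (X, ρ_x) be a finite-dimensional complete metric space, f : X → X continuous, U a set, and F : X × U → X with f(x̂) ∈ F(x̂, U) for all x̂ ∈ X. Let ℓ : X × X → ℝ_{≥0} be symmetric with α₁(ρ_x(ξ,ζ)) ≤ ℓ(ξ,ζ) ≤ α₂(ρ_x(ξ,ζ)) for all ξ, ζ ∈ X, where α₁, α₂ ∈ K∞. Let N ≥ 1 and for x̂, x ∈ X let V(x̂, x) be the minimum of Σ_{i=0}^{N−1} ℓ(z_{i+1}, f(z_i)) over all sequences (z_i)_{i=0}^{N} with z₀ = x̂, z_{i+1} ∈ F(z_i, U), and z_N = f^N(x); let (φ_i(x̂,x))_{i=0}^{N} be the minimizing sequence. Assume: (i) V is continuous and there exist α₃, α₄ ∈ K∞ with α₃(ρ_x(x̂,x)) ≤ V(x̂,x) ≤ α₄(ρ_x(x̂,x)) for all x̂, x ∈ X; (ii) the minimizing sequence is unique for every (x̂, x) and φ₁ is continuous. Let (x_k) solve x_{k+1} = f(x_k) and let the tracker evolve by x̂_{k+1} = φ₁(x̂_k, x_k). Then: (a) for each ε > 0 there exists δ > 0 such that ρ_x(x̂₀, x₀) ≤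 δ implies ρ_x(x̂_k, x_k) ≤ ε for all k ∈ ℕ; (b) if moreover x̂_k and x_k remain in a bounded region D ⊂ X for all k ∈ ℕ, then ρ_x(x̂_k, x_k) → 0 as k → ∞. -/
open Filter Finset

/-- A sequence `z` is feasible w.r.t. `(x̂, x)`: `z₀ = x̂`, `z_{i+1} ∈ F(z_i, U)` for
`i < N`, and `z_N = f^N(x)`. -/
def Feas {X U : Type*} (f : X → X) (F : X → U → X) (N : ℕ) (xhat x : X)
    (zs : ℕ → X) : Prop :=
  zs 0 = xhat ∧ (∀ i < N, ∃ u : U, zs (i + 1) = F (zs i) u) ∧ zs N = f^[N] x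

/-- The tracking cost `Σ_{i=0}^{N-1} ℓ(z_{i+1}, f(z_i))`. -/
def trackCost {X : Type*} (f : X → X) (ℓ : X → X → ℝ) (N : ℕ) (zs : ℕ → X) : ℝ :=
  ∑ i ∈ Finset.range N, ℓ (zs (i + 1)) (f (zs i))

lemma IsKInf.pos_s16 {α : ℝ → ℝ} (h : IsKInf α) {r : ℝ} (hr : 0 < r) : 0 < α r := by
  have := h.2.2.1 (Set.mem_Ici.2 le_rfl) (Set.mem_Ici.2 hr.le) hr
  rwa [h.2.1] at this

lemma IsKInf.nonneg_s16 {α : ℝ → ℝ} (h : IsKInf α) {r : ℝ} (hr : 0 ≤ r) : 0 ≤ α r := by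
  rcases hr.eq_or_lt with rfl | hr
  · exact h.2.1.ge
  · exact (h.pos_s16 hr).le

lemma IsKInf.exists_pos_forall_lt {α : ℝ → ℝ} (h : IsKInf α) {r : ℝ} (hr : 0 < r) :
    ∃ δ > 0, ∀ s, 0 ≤ s → s ≤ δ → α s < r := by
  obtain ⟨δ, hδ, H⟩ := Metric.continuousWithinAt_iff.1 (h.1 0 (Set.mem_Ici.2 le_rfl)) r hr
  refine ⟨δ / 2, half_pos hδ, fun s hs hsδ => ?_⟩
  have := H (Set.mem_Ici.2 hs) (by rw [Real.dist_eq, sub_zero, abs_of_nonneg hs]; linarith)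
  rw [h.2.1, Real.dist_eq, sub_zero] at this
  exact lt_of_abs_lt this

/-- Drop the first point of a sequence of length `N` and append one step of `f`. -/
def shiftSeq {X : Type*} (f : X → X) (N : ℕ) (zs : ℕ → X) (j : ℕ) : X :=
  if j < N then zs (j + 1) else f (zs N)

lemma Feas.shiftSeq {X U : Type*} {f : X → X} {F : X → U → X}
    (hF : ∀ xhat : X, ∃ u : U, F xhat u = f xhat) {N : ℕ} (hN : 1 ≤ N) {xhat x : X}
    {zs : ℕ → X} (h : Feas f F N xhat x zs) :
    Feas f F N (zs 1) (f x) (shiftSeq f N zs) := by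
  refine ⟨?_, fun i hi => ?_, ?_⟩
  · simp [_root_.shiftSeq, Nat.lt_of_lt_of_le Nat.zero_lt_one hN]
  · by_cases hi' : i + 1 < N
    · simpa [_root_.shiftSeq, hi, hi'] using h.2.1 (i + 1) hi'
    · obtain rfl : N = i + 1 := by omega
      obtain ⟨u, hu⟩ := hF (zs (i + 1))
      exact ⟨u, by simp [_root_.shiftSeq, hu]⟩
  · simp only [_root_.shiftSeq, lt_irrefl, if_false, h.2.2]
    rw [← Function.iterate_succ_apply' f, Function.iterate_succ_apply]

lemma trackCost_shiftSeq {X : Type*} (f : X → X) {ℓ : X → X → ℝ} (hℓ : ∀ ξ, ℓ ξ ξ = 0)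
    {N : ℕ} (hN : 1 ≤ N) (zs : ℕ → X) :
    trackCost f ℓ N (shiftSeq f N zs) = trackCost f ℓ N zs - ℓ (zs 1) (f (zs 0)) := by
  obtain ⟨m, rfl⟩ : ∃ m, N = m + 1 := ⟨N - 1, by omega⟩
  unfold trackCost
  rw [Finset.sum_range_succ, Finset.sum_range_succ' (fun i => ℓ (zs (i + 1)) (f (zs i)))]
  have hlast : ℓ (shiftSeq f (m + 1) zs (m + 1)) (f (shiftSeq f (m + 1) zs m)) = 0 := by
    simp [shiftSeq, hℓ]
  rw [hlast, add_zero, zero_add, add_sub_cancel_right]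
  refine Finset.sum_congr rfl fun i hi => ?_
  have hi := Finset.mem_range.1 hi
  simp [shiftSeq, hi, Nat.lt_succ_of_lt hi]

/-- If the value function does not decrease along the closed loop `G`, each stage cost of the
optimal sequence vanishes. -/
lemma stage_cost_eq_zero {X U : Type*} {f : X → X} {F : X → U → X}
    (hF : ∀ xhat : X, ∃ u : U, F xhat u = f xhat) {ℓ : X → X → ℝ}
    (hℓ₀ : ∀ ξ ζ, 0 ≤ ℓ ξ ζ) (hℓ : ∀ ξ, ℓ ξ ξ = 0) {N : ℕ} (hN : 1 ≤ N)
    {V : X → X → ℝ} {φ : X → X → ℕ → X}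
    (hφfeas : ∀ xhat x, Feas f F N xhat x (φ xhat x))
    (hφopt : ∀ xhat x zs, Feas f F N xhat x zs →
      trackCost f ℓ N (φ xhat x) ≤ trackCost f ℓ N zs)
    (hV : ∀ xhat x, V xhat x = trackCost f ℓ N (φ xhat x))
    (huniq : ∀ xhat x zs, Feas f F N xhat x zs →
      trackCost f ℓ N zs = V xhat x → ∀ i ≤ N, zs i = φ xhat x i)
    {G : X × X → X × X} (hG : ∀ p, G p = (φ p.1 p.2 1, f p.2))
    {c : ℝ} (i : ℕ) (hi : i < N) (p : X × X)
    (hc : ∀ k, V (G^[k] p).1 (G^[k] p).2 = c) :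
    ℓ (φ p.1 p.2 (i + 1)) (f (φ p.1 p.2 i)) = 0 := by
  have hfeas := (hφfeas p.1 p.2).shiftSeq hF hN
  have hcost := trackCost_shiftSeq f hℓ hN (φ p.1 p.2)
  have hle := hφopt _ _ _ hfeas
  have h0 : V p.1 p.2 = c := hc 0
  have h1 : V (φ p.1 p.2 1) (f p.2) = c := by simpa [hG] using hc 1
  have hz := hℓ₀ (φ p.1 p.2 1) (f (φ p.1 p.2 0))
  have hVp := hV p.1 p.2
  have hVq := hV (φ p.1 p.2 1) (f p.2)
  induction i generalizing p with
  | zero => rw [zero_add]; linarith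
  | succ i ih =>
    have heq := huniq _ _ _ hfeas (by linarith)
    have e1 := heq i (by omega)
    have e2 := heq (i + 1) (by omega)
    simp only [shiftSeq, hi, if_true, (by omega : i < N)] at e1 e2
    rw [e1, e2]
    have hc' : ∀ k, V (G^[k] (G p)).1 (G^[k] (G p)).2 = c := fun k => hc (k + 1)
    rw [hG p] at hc'
    have h1' := hc' 1
    rw [Function.iterate_one, hG] at h1'
    exact ih (by omega) (φ p.1 p.2 1, f p.2) hc' ((hφfeas _ _).shiftSeq hF hN)
      (trackCost_shiftSeq f hℓ hN _) (hφopt _ _ _ ((hφfeas _ _).shiftSeq hF hN)) h1 h1'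
      (hℓ₀ _ _) (hV _ _) (hV _ _)

/-- **Theorem 5 (`thm:asycon`): nonlinear moving-horizon optimal tracker.**
Under Assumption 3 (continuity and positive definiteness of the optimal cost `V`,
uniqueness of the minimizing sequence `φ`, continuity of `φ₁`), the tracker
`x̂⁺ = φ₁(x̂, x)` is stable; if moreover the solutions stay in a bounded region,
the tracking error converges to zero. -/
theorem stmt_16 {X : Type*} [MetricSpace X] [ProperSpace X] [CompleteSpace X]
    {U : Type*} (f : X → X) (hf : Continuous f)
    (F : X → U → X) (hF : ∀ xhat : X, ∃ u : U, F xhat u = f xhat)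
    (ℓ : X → X → ℝ) (hsym : ∀ ξ ζ, ℓ ξ ζ = ℓ ζ ξ)
    (α₁ α₂ : ℝ → ℝ) (hα₁ : IsKInf α₁) (hα₂ : IsKInf α₂)
    (hℓ : ∀ ξ ζ, α₁ (dist ξ ζ) ≤ ℓ ξ ζ ∧ ℓ ξ ζ ≤ α₂ (dist ξ ζ))
    (N : ℕ) (hN : 1 ≤ N)
    (V : X → X → ℝ) (φ : X → X → ℕ → X)
    (hφfeas : ∀ xhat x, Feas f F N xhat x (φ xhat x))
    (hφopt : ∀ xhat x zs, Feas f F N xhat x zs →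
      trackCost f ℓ N (φ xhat x) ≤ trackCost f ℓ N zs)
    (hV : ∀ xhat x, V xhat x = trackCost f ℓ N (φ xhat x))
    (hVcont : Continuous fun p : X × X => V p.1 p.2)
    (α₃ α₄ : ℝ → ℝ) (hα₃ : IsKInf α₃) (hα₄ : IsKInf α₄)
    (hVbound : ∀ xhat x, α₃ (dist xhat x) ≤ V xhat x ∧ V xhat x ≤ α₄ (dist xhat x))
    (huniq : ∀ xhat x zs, Feas f F N xhat x zs →
      trackCost f ℓ N zs = V xhat x → ∀ i ≤ N, zs i = φ xhat x i)
    (hφ₁cont : Continuous fun p : X × X => φ p.1 p.2 1) :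
    (∀ ε > (0 : ℝ), ∃ δ > (0 : ℝ), ∀ x xhat : ℕ → X,
      (∀ k, x (k + 1) = f (x k)) → (∀ k, xhat (k + 1) = φ (xhat k) (x k) 1) →
      dist (xhat 0) (x 0) ≤ δ → ∀ k, dist (xhat k) (x k) ≤ ε) ∧
    (∀ x xhat : ℕ → X,
      (∀ k, x (k + 1) = f (x k)) → (∀ k, xhat (k + 1) = φ (xhat k) (x k) 1) →
      (∃ D : Set X, Bornology.IsBounded D ∧ ∀ k, x k ∈ D ∧ xhat k ∈ D) →
      Tendsto (fun k => dist (xhat k) (x k)) atTop (nhds 0)) := by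
  have hℓ₀ : ∀ ξ ζ, 0 ≤ ℓ ξ ζ := fun ξ ζ => (hα₁.nonneg_s16 dist_nonneg).trans (hℓ ξ ζ).1
  have hℓd : ∀ ξ, ℓ ξ ξ = 0 := fun ξ =>
    le_antisymm (by simpa [hα₂.2.1] using (hℓ ξ ξ).2) (hℓ₀ ξ ξ)
  have hV₀ : ∀ a b, 0 ≤ V a b := fun a b => (hα₃.nonneg_s16 dist_nonneg).trans (hVbound a b).1
  have hdec : ∀ a b, V (φ a b 1) (f b) ≤ V a b := by
    intro a b
    have h1 := hφopt _ _ _ ((hφfeas a b).shiftSeq hF hN)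
    rw [trackCost_shiftSeq f hℓd hN, ← hV, ← hV] at h1
    linarith [hℓ₀ (φ a b 1) (f (φ a b 0))]
  have hlt : ∀ a b ε, 0 < ε → V a b < α₃ ε → dist a b < ε := fun a b ε hε h =>
    (hα₃.2.2.1.lt_iff_lt (Set.mem_Ici.2 dist_nonneg) (Set.mem_Ici.2 hε.le)).1
      ((hVbound a b).1.trans_lt h)
  have hanti : ∀ x xhat : ℕ → X, (∀ k, x (k + 1) = f (x k)) →
      (∀ k, xhat (k + 1) = φ (xhat k) (x k) 1) → Antitone fun k => V (xhat k) (x k) := by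
    intro x xhat hx hxhat
    refine antitone_nat_of_succ_le fun k => ?_
    rw [hx, hxhat]
    exact hdec _ _
  constructor
  · intro ε hε
    obtain ⟨δ, hδ, H⟩ := hα₄.exists_pos_forall_lt (hα₃.pos_s16 hε)
    refine ⟨δ, hδ, fun x xhat hx hxhat h0 k => (hlt _ _ _ hε ?_).le⟩
    exact ((hanti x xhat hx hxhat (Nat.zero_le k)).trans (hVbound _ _).2).trans_lt
      (H _ dist_nonneg h0)
  · rintro x xhat hx hxhat ⟨D, hD, hmem⟩
    have hlim := tendsto_atTop_ciInf (hanti x xhat hx hxhat)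
      ⟨0, by rintro _ ⟨k, rfl⟩; exact hV₀ _ _⟩
    set c := ⨅ k, V (xhat k) (x k)
    obtain ⟨p, -, ψ, hψ, hp⟩ := tendsto_subseq_of_bounded (hD.prod hD)
      (x := fun k => (xhat k, x k)) fun k => ⟨(hmem k).2, (hmem k).1⟩
    let G : X × X → X × X := fun q => (φ q.1 q.2 1, f q.2)
    have hGcont : Continuous G := hφ₁cont.prodMk (hf.comp continuous_snd)
    have hGk : ∀ k n, G^[k] (xhat n, x n) = (xhat (n + k), x (n + k)) := by
      intro k n
      induction k with
      | zero => rfl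
      | succ k ih =>
        rw [Function.iterate_succ_apply', ih, ← add_assoc, hx, hxhat]
    have hc : ∀ k, V (G^[k] p).1 (G^[k] p).2 = c := by
      intro k
      have h1 := ((hVcont.comp (hGcont.iterate k)).tendsto p).comp hp
      refine tendsto_nhds_unique h1 ?_
      have h2 := hlim.comp ((tendsto_add_atTop_nat k).comp hψ.tendsto_atTop)
      refine h2.congr fun n => ?_
      simp [hGk]
    have hc0 : c = 0 := by
      rw [← hc 0, Function.iterate_zero, id, hV]
      refine Finset.sum_eq_zero fun i hi => ?_
      exact stage_cost_eq_zero hF hℓ₀ hℓd hN hφfeas hφopt hV huniq (G := G) (fun _ => rfl) i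
        (Finset.mem_range.1 hi) p hc
    rw [hc0] at hlim
    rw [Metric.tendsto_atTop]
    intro ε hε
    obtain ⟨n, hn⟩ := eventually_atTop.1 (hlim.eventually_lt_const (hα₃.pos_s16 hε))
    refine ⟨n, fun k hk => ?_⟩
    rw [Real.dist_eq, sub_zero, abs_of_nonneg dist_nonneg]
    exact hlt _ _ _ hε (hn k hk)
end

section
/- Let (X, ρ_x) be a finite-dimensional complete metric space, f : X → X, U a set, and F : X × U → X with f(x̂) ∈ F(x̂, U) for all x̂ ∈ X. Let ℓ : X × X → ℝ_{≥0}, N ≥ 1, and for x̂, x ∈ X let V(x̂, x) be the minimum of Σ_{i=0}^{N−1} ℓ(z_{i+1}, f(z_i)) over all sequences (z_i)_{i=0}^{N} with z₀ = x̂, z_{i+1} ∈ F(z_i, U), z_N = f^N(x), attained by the sequence (φ_i(x̂,x))_{i=0}^{N}. Then, setting x̂⁺ := φ₁(x̂, x) and x⁺ := f(x), one has V(x̂⁺, x⁺) − V(x̂, x) ≤ −ℓ(φ₁(x̂, x), f(x̂)); consequently, along the trajectory x̂_{k+1} = φ₁(x̂_k, x_k), x_{k+1} = f(x_k), the sequence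 V(x̂_k, x_k) is nonincreasing in k. -/
open Filter Finset

/-- The tail of a sequence feasible for `(xhat, x)`, extended by one step of `f`, is feasible for
`(zs 1, f x)`, and its tracking cost is smaller by the first stage cost. -/
theorem Feas.exists_shift {X U : Type*} {f : X → X} {F : X → U → X}
    (hF : ∀ xhat : X, ∃ u : U, F xhat u = f xhat) {ℓ : X → X → ℝ} (hℓself : ∀ ξ, ℓ ξ ξ = 0)
    {N : ℕ} (hN : 1 ≤ N) {xhat x : X} {zs : ℕ → X} (h : Feas f F N xhat x zs) :
    ∃ ws, Feas f F N (zs 1) (f x) ws ∧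
      trackCost f ℓ N ws = trackCost f ℓ N zs - ℓ (zs 1) (f xhat) := by
  obtain ⟨M, rfl⟩ : ∃ M, N = M + 1 := ⟨N - 1, by omega⟩
  obtain ⟨h0, hstep, hend⟩ := h
  have hle : ∀ i ≤ M, (if i ≤ M then zs (i + 1) else f (zs (M + 1))) = zs (i + 1) :=
    fun i hi => if_pos hi
  have hlast : (if M + 1 ≤ M then zs (M + 1 + 1) else f (zs (M + 1))) = f (zs (M + 1)) :=
    if_neg (by omega)
  refine ⟨fun i => if i ≤ M then zs (i + 1) else f (zs (M + 1)), ⟨?_, ?_, ?_⟩, ?_⟩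
  · exact hle 0 (Nat.zero_le M)
  · intro i hi
    dsimp only
    rw [hle i (by omega)]
    rcases Nat.lt_succ_iff_lt_or_eq.mp hi with hi | rfl
    · rw [hle (i + 1) hi]
      exact hstep (i + 1) (by omega)
    · rw [hlast]
      obtain ⟨u, hu⟩ := hF (zs (i + 1))
      exact ⟨u, hu.symm⟩
  · dsimp only
    rw [hlast, hend, ← Function.iterate_succ_apply' f, ← Function.iterate_succ_apply f]
  · unfold trackCost
    rw [Finset.sum_range_succ, Finset.sum_range_succ' _ M]
    dsimp only
    rw [hlast, hle M le_rfl, hℓself, h0]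
    have hsum : ∀ i ∈ Finset.range M,
        ℓ (if i + 1 ≤ M then zs (i + 1 + 1) else f (zs (M + 1)))
          (f (if i ≤ M then zs (i + 1) else f (zs (M + 1)))) =
        ℓ (zs (i + 1 + 1)) (f (zs (i + 1))) := by
      intro i hi
      have hi' := Finset.mem_range.mp hi
      rw [hle i hi'.le, hle (i + 1) hi']
    rw [Finset.sum_congr rfl hsum]
    ring

/-- **The optimality decrease inequality (eqn. `eqn:decrease`).**
With `x̂⁺ = φ₁(x̂, x)` and `x⁺ = f(x)`, one has
`V(x̂⁺, x⁺) - V(x̂, x) ≤ -ℓ(φ₁(x̂, x), f(x̂))`; consequently `V(x̂_k, x_k)` is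
nonincreasing along the closed-loop trajectory. -/
theorem stmt_17 {X : Type*} [MetricSpace X] [ProperSpace X] [CompleteSpace X]
    {U : Type*} (f : X → X)
    (F : X → U → X) (hF : ∀ xhat : X, ∃ u : U, F xhat u = f xhat)
    (ℓ : X → X → ℝ) (hℓ : ∀ ξ ζ, 0 ≤ ℓ ξ ζ) (hℓself : ∀ ξ, ℓ ξ ξ = 0)
    (N : ℕ) (hN : 1 ≤ N)
    (V : X → X → ℝ) (φ : X → X → ℕ → X)
    (hφfeas : ∀ xhat x, Feas f F N xhat x (φ xhat x))
    (hφopt : ∀ xhat x zs, Feas f F N xhat x zs →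
      trackCost f ℓ N (φ xhat x) ≤ trackCost f ℓ N zs)
    (hV : ∀ xhat x, V xhat x = trackCost f ℓ N (φ xhat x)) :
    (∀ xhat x : X,
      V (φ xhat x 1) (f x) - V xhat x ≤ -ℓ (φ xhat x 1) (f xhat)) ∧
    (∀ x xhat : ℕ → X,
      (∀ k, x (k + 1) = f (x k)) → (∀ k, xhat (k + 1) = φ (xhat k) (x k) 1) →
      ∀ k, V (xhat (k + 1)) (x (k + 1)) ≤ V (xhat k) (x k)) := by
  have hdecrease : ∀ xhat x : X,
      V (φ xhat x 1) (f x) - V xhat x ≤ -ℓ (φ xhat x 1) (f xhat) := by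
    intro xhat x
    obtain ⟨ws, hws, hcost⟩ := (hφfeas xhat x).exists_shift hF hℓself hN
    have hopt := hφopt _ _ ws hws
    rw [hV, hV]
    linarith
  refine ⟨hdecrease, fun x xhat hx hxhat k => ?_⟩
  rw [hx, hxhat]
  linarith [hdecrease (xhat k) (x k), hℓ (φ (xhat k) (x k) 1) (f (xhat k))]
end

section
/- Let A ∈ ℝ^{n×n} and C ∈ ℝ^{1×n} be such that the observability matrix O := [Cᵀ, AᵀCᵀ, …, A^{(n−1)T}Cᵀ]ᵀ ∈ ℝ^{n×n} is nonsingular. Let e_n := (0, …, 0, 1)ᵀ ∈ ℝ^n and define the observer gain L := A^n O^{−1} e_n ∈ ℝ^n. Then (A − L C)^n = 0; equivalently, for any solution (x_k) of x_{k+1} = A x_k with y_k = C x_k and any initial condition x̂₀, the observer x̂_{k+1} = A x̂_k + L (y_k − C x̂_k) satisfies x̂_k = x_k for all k ≥ n. -/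
open Matrix

/-- The observability matrix `O = [Cᵀ, AᵀCᵀ, …, A^{(n-1)T}Cᵀ]ᵀ` of a single-output
system: its `i`-th row is `C A^i`. -/
noncomputable def obsMat {n : ℕ} (A : Matrix (Fin n) (Fin n) ℝ)
    (C : Matrix (Fin 1) (Fin n) ℝ) : Matrix (Fin n) (Fin n) ℝ :=
  Matrix.of fun i j => (C * A ^ (i : ℕ)) 0 j

/-- The last standard basis vector `e_n = (0, …, 0, 1)ᵀ`. -/
def lastBasis (n : ℕ) : Fin n → ℝ := fun i => if (i : ℕ) = n - 1 then 1 else 0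

theorem obsMat_mulVec_apply {n : ℕ} (A : Matrix (Fin n) (Fin n) ℝ)
    (C : Matrix (Fin 1) (Fin n) ℝ) (w : Fin n → ℝ) (i : Fin n) :
    (obsMat A C *ᵥ w) i = C 0 ⬝ᵥ (A ^ (i : ℕ) *ᵥ w) := by
  rw [dotProduct_mulVec]
  rfl

theorem sub_vecMulVec_mulVec {n : ℕ} (A : Matrix (Fin n) (Fin n) ℝ) (L c w : Fin n → ℝ) :
    (A - vecMulVec L c) *ᵥ w = A *ᵥ w - (c ⬝ᵥ w) • L := by
  rw [sub_mulVec, vecMulVec_mulVec]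
  simp

/-- The closed loop acts on the chain `v, A v, …, A^(n-1) v` as a nilpotent shift. -/
theorem sub_vecMulVec_pow_mulVec_pow_mulVec {n : ℕ} (A : Matrix (Fin n) (Fin n) ℝ)
    (c v : Fin n → ℝ)
    (hv : ∀ i < n, c ⬝ᵥ (A ^ i *ᵥ v) = if i = n - 1 then 1 else 0) (j : ℕ) :
    ∀ k, k + j + 1 = n →
      (A - vecMulVec (A ^ n *ᵥ v) c) ^ (j + 1) *ᵥ (A ^ k *ᵥ v) = 0 := by
  induction j with
  | zero =>
    intro k hk
    rw [zero_add, pow_one, sub_vecMulVec_mulVec, hv k (by omega), if_pos (by omega), one_smul,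
      mulVec_mulVec, ← pow_succ', show k + 1 = n from hk, sub_self]
  | succ j ih =>
    intro k hk
    rw [pow_succ, ← mulVec_mulVec, sub_vecMulVec_mulVec, hv k (by omega), if_neg (by omega),
      zero_smul, sub_zero, mulVec_mulVec _ A, ← pow_succ']
    exact ih (k + 1) (by omega)

theorem sub_vecMulVec_pow_eq_zero {n : ℕ} (A : Matrix (Fin n) (Fin n) ℝ) (c v : Fin n → ℝ)
    (hv : ∀ i < n, c ⬝ᵥ (A ^ i *ᵥ v) = if i = n - 1 then 1 else 0)
    (hobs : ∀ w : Fin n → ℝ, (∀ i < n, c ⬝ᵥ (A ^ i *ᵥ w) = 0) → w = 0) :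
    (A - vecMulVec (A ^ n *ᵥ v) c) ^ n = 0 := by
  set M := A - vecMulVec (A ^ n *ᵥ v) c
  have hchain : ∀ k < n, M ^ n *ᵥ (A ^ k *ᵥ v) = 0 := by
    intro k hk
    have h : M ^ n = M ^ k * M ^ (n - k - 1 + 1) := by
      rw [← pow_add]
      congr 1
      omega
    rw [h, ← mulVec_mulVec, sub_vecMulVec_pow_mulVec_pow_mulVec A c v hv _ k (by omega),
      mulVec_zero]
  -- Vectors whose first `n - k` outputs vanish are combinations of `v, …, A^(k-1) v`.
  have hker : ∀ k ≤ n, ∀ w : Fin n → ℝ, (∀ i < n - k, c ⬝ᵥ (A ^ i *ᵥ w) = 0) →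
      M ^ n *ᵥ w = 0 := by
    intro k
    induction k with
    | zero =>
      intro _ w hw
      rw [hobs w hw, mulVec_zero]
    | succ k ih =>
      intro hk w hw
      have h := ih (by omega) (w - (c ⬝ᵥ (A ^ (n - k - 1) *ᵥ w)) • (A ^ k *ᵥ v)) (by
        intro i hi
        rw [mulVec_sub, mulVec_smul, mulVec_mulVec, ← pow_add, dotProduct_sub, dotProduct_smul,
          hv (i + k) (by omega)]
        by_cases hik : i = n - k - 1
        · rw [if_pos (by omega), hik]
          simp
        · rw [if_neg (by omega), hw i (by omega)]
          simp)
      rwa [mulVec_sub, mulVec_smul, hchain k (by omega), smul_zero, sub_zero] at h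
  refine ext_of_mulVec_single fun i => ?_
  rw [hker n le_rfl _ (by simp), zero_mulVec]

/-- **The linear deadbeat observer (gain `L = A^n O⁻¹ e_n`, eqn. `eqn:thrush`).**
`(A - L C)^n = 0`, and the observer `x̂⁺ = A x̂ + L (y - C x̂)` recovers the state:
`x̂_k = x_k` for all `k ≥ n`. -/
theorem stmt_18 {n : ℕ} (A : Matrix (Fin n) (Fin n) ℝ) (C : Matrix (Fin 1) (Fin n) ℝ)
    (hO : IsUnit (obsMat A C).det)
    (L : Fin n → ℝ) (hL : L = (A ^ n * (obsMat A C)⁻¹).mulVec (lastBasis n)) :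
    (A - Matrix.vecMulVec L (fun j => C 0 j)) ^ n = 0 ∧
    ∀ x xhat : ℕ → Fin n → ℝ,
      (∀ k, x (k + 1) = A.mulVec (x k)) →
      (∀ k, xhat (k + 1) =
        A.mulVec (xhat k) + (C.mulVec (x k) 0 - C.mulVec (xhat k) 0) • L) →
      ∀ k, n ≤ k → xhat k = x k := by
  have hv : ∀ i < n, C 0 ⬝ᵥ (A ^ i *ᵥ ((obsMat A C)⁻¹ *ᵥ lastBasis n)) =
      if i = n - 1 then 1 else 0 := by
    intro i hi
    rw [← obsMat_mulVec_apply A C _ ⟨i, hi⟩, mulVec_mulVec, mul_nonsing_inv _ hO, one_mulVec]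
    rfl
  have hobs : ∀ w : Fin n → ℝ, (∀ i < n, C 0 ⬝ᵥ (A ^ i *ᵥ w) = 0) → w = 0 := by
    intro w hw
    have h : obsMat A C *ᵥ w = 0 := by
      ext i
      rw [obsMat_mulVec_apply, hw i i.isLt, Pi.zero_apply]
    rw [← one_mulVec w, ← nonsing_inv_mul _ hO, ← mulVec_mulVec, h, mulVec_zero]
  have hpow : (A - vecMulVec L (fun j => C 0 j)) ^ n = 0 := by
    rw [hL, ← mulVec_mulVec]
    exact sub_vecMulVec_pow_eq_zero A (C 0) _ hv hobs
  refine ⟨hpow, fun x xhat hx hxhat k hk => ?_⟩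
  have herr : ∀ k, xhat k - x k =
      (A - vecMulVec L (fun j => C 0 j)) ^ k *ᵥ (xhat 0 - x 0) := by
    intro k
    induction k with
    | zero => simp
    | succ k ih =>
      rw [pow_succ', ← mulVec_mulVec, ← ih, sub_vecMulVec_mulVec, hx, hxhat, mulVec_sub,
        dotProduct_sub]
      simp only [mulVec, sub_smul]
      abel
  rw [← sub_eq_zero, herr, pow_eq_zero_of_le hk hpow, zero_mulVec]
end
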